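/- (Kollár) Let F be a field of characteristic zero and let T ∈ F[t] be a polynomial that is not a constant. Then every solution (X, Y) ∈ F[t] × F[t] of the Pell equation X² − (T²−1)·Y² = 1 is either of the form (±1, 0), or of the form (±X_N, ±Y_N) for some positive integer N, where the two signs are chosen independently. In other words, the group of solutions of this Pell equation under the composition (X,Y)∘(X',Y') = (XX' + (T²−1)YY', XY' + X'Y) is generated by the element (T, 1) together with (−1, 0). -/

import Mathlib

open Finset Polynomial

/-- `X_N = Σ_{k=0}^{⌊N/2⌋} C(N,2k)·(T²−1)^k·T^{N−2k}`. -/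
noncomputable def pellX {R : Type*} [CommRing R] (T : R) (N : ℕ) : R :=
  ∑ k ∈ Finset.range (N / 2 + 1),
    (N.choose (2 * k) : R) * (T ^ 2 - 1) ^ k * T ^ (N - 2 * k)

/-- `Y_N = Σ_{k=0}^{⌊N/2⌋} C(N,2k+1)·(T²−1)^k·T^{N−1−2k}`. -/
noncomputable def pellY {R : Type*} [CommRing R] (T : R) (N : ℕ) : R :=
  ∑ k ∈ Finset.range (N / 2 + 1),
    (N.choose (2 * k + 1) : R) * (T ^ 2 - 1) ^ k * T ^ (N - 1 - 2 * k)

theorem pellX_ext {R : Type*} [CommRing R] (T : R) (N M : ℕ) (hM : N / 2 + 1 ≤ M) :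
    pellX T N = ∑ k ∈ Finset.range M,
      (N.choose (2 * k) : R) * (T ^ 2 - 1) ^ k * T ^ (N - 2 * k) := by
  unfold pellX
  apply Finset.sum_subset (Finset.range_mono hM)
  intro k _ hk
  rw [Finset.mem_range] at hk
  rw [Nat.choose_eq_zero_of_lt (by omega)]
  simp

theorem pellY_ext {R : Type*} [CommRing R] (T : R) (N M : ℕ) (hM : N / 2 + 1 ≤ M) :
    pellY T N = ∑ k ∈ Finset.range M,
      (N.choose (2 * k + 1) : R) * (T ^ 2 - 1) ^ k * T ^ (N - 1 - 2 * k) := by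
  unfold pellY
  apply Finset.sum_subset (Finset.range_mono hM)
  intro k _ hk
  rw [Finset.mem_range] at hk
  rw [Nat.choose_eq_zero_of_lt (by omega)]
  simp

theorem pellY_succ {R : Type*} [CommRing R] (T : R) (N : ℕ) :
    pellY T (N + 1) = pellX T N + pellY T N * T := by
  rw [pellY_ext T (N + 1) (N + 2) (by omega), pellX_ext T N (N + 2) (by omega),
    pellY_ext T N (N + 2) (by omega), Finset.sum_mul, ← Finset.sum_add_distrib]
  refine Finset.sum_congr rfl fun k _ => ?_
  rw [Nat.choose_succ_succ, Nat.add_sub_cancel]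
  push_cast
  by_cases hk : 2 * k + 1 ≤ N
  · have e : N - 2 * k = (N - 1 - 2 * k) + 1 := by omega
    rw [e, pow_succ]
    ring
  · rw [Nat.choose_eq_zero_of_lt (show N < 2 * k + 1 by omega)]
    simp

theorem pellX_succ {R : Type*} [CommRing R] (T : R) (N : ℕ) :
    pellX T (N + 1) = pellX T N * T + (T ^ 2 - 1) * pellY T N := by
  rw [pellX_ext T (N + 1) (N + 2 + 1) (by omega), pellX_ext T N (N + 2 + 1) (by omega),
    pellY_ext T N (N + 2) (by omega), Finset.sum_range_succ', Finset.sum_range_succ' _ (N + 2),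
    add_mul, Finset.sum_mul, Finset.mul_sum, add_right_comm, ← Finset.sum_add_distrib]
  congr 1
  · refine Finset.sum_congr rfl fun k _ => ?_
    rw [show 2 * (k + 1) = 2 * k + 1 + 1 by ring, Nat.choose_succ_succ]
    push_cast
    rw [Nat.succ_eq_add_one, show N - (2 * k + 1) = N - 1 - 2 * k by omega]
    by_cases hk : 2 * k + 1 + 1 ≤ N
    · have e : N - 1 - 2 * k = (N - (2 * k + 1 + 1)) + 1 := by omega
      rw [e, pow_succ]
      ring
    · rw [Nat.choose_eq_zero_of_lt (show N < 2 * k + 1 + 1 by omega)]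
      simp
      ring
  · simp [pow_succ]

theorem pell_descent {F : Type*} [Field F] [CharZero F]
    (T : Polynomial F) (hT : 0 < T.natDegree) (m : ℕ) :
    ∀ X Y : Polynomial F, Y.natDegree = m → X ^ 2 - (T ^ 2 - 1) * Y ^ 2 = 1 →
      ∃ N : ℕ, (X = pellX T N ∨ X = -pellX T N) ∧ (Y = pellY T N ∨ Y = -pellY T N) := by
  have hX0 : pellX T 0 = 1 := by simp [pellX]
  have hY0 : pellY T 0 = 0 := by simp [pellY]
  induction m using Nat.strong_induction_on with
  | _ m ih =>
  -- the key step
  have key : ∀ X Y : Polynomial F, Y.natDegree = m → X ^ 2 - (T ^ 2 - 1) * Y ^ 2 = 1 →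
      (Y * T - X).natDegree < m →
      ∃ N : ℕ, (X = pellX T N ∨ X = -pellX T N) ∧ (Y = pellY T N ∨ Y = -pellY T N) := by
    intro X Y hm h hlt
    obtain ⟨N, h1, h2⟩ := ih _ hlt (X * T - (T ^ 2 - 1) * Y) (Y * T - X) rfl
      (by linear_combination h)
    have eX : X = (X * T - (T ^ 2 - 1) * Y) * T + (T ^ 2 - 1) * (Y * T - X) := by ring
    have eY : Y = (X * T - (T ^ 2 - 1) * Y) + (Y * T - X) * T := by ring
    generalize X * T - (T ^ 2 - 1) * Y = X' at *
    generalize Y * T - X = Y' at *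
    have hs := pellX_succ T N
    have hs' := pellY_succ T N
    rcases h1 with rfl | rfl <;> rcases h2 with rfl | rfl
    · exact ⟨N + 1, Or.inl (by rw [eX, hs]), Or.inl (by rw [eY, hs'])⟩
    · cases N with
      | zero => exact ⟨1, Or.inl (by rw [eX, hs, hY0]; ring), Or.inl (by rw [eY, hs', hY0]; ring)⟩
      | succ n =>
        have a := pellX_succ T n
        have b := pellY_succ T n
        exact ⟨n, Or.inl (by rw [eX, a, b]; ring), Or.inr (by rw [eY, a, b]; ring)⟩
    · cases N with
      | zero => exact ⟨1, Or.inr (by rw [eX, hs, hY0]; ring), Or.inr (by rw [eY, hs', hY0]; ring)⟩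
      | succ n =>
        have a := pellX_succ T n
        have b := pellY_succ T n
        exact ⟨n, Or.inr (by rw [eX, a, b]; ring), Or.inl (by rw [eY, a, b]; ring)⟩
    · exact ⟨N + 1, Or.inr (by rw [eX, hs]; ring), Or.inr (by rw [eY, hs']; ring)⟩
  intro X Y hm h
  by_cases hY : Y = 0
  · subst hY
    refine ⟨0, ?_, Or.inl hY0.symm⟩
    rw [hX0]
    exact (sq_eq_sq_iff_eq_or_eq_neg (b := (1 : Polynomial F))).mp (by linear_combination h)
  by_cases hY1 : Y ^ 2 = 1
  · have b := pellY_succ T 0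
    have a := pellX_succ T 0
    rw [hX0, hY0] at a b
    refine ⟨1, ?_, ?_⟩
    · rw [show pellX T 1 = T by rw [a]; ring]
      exact sq_eq_sq_iff_eq_or_eq_neg.mp (by linear_combination h + (T ^ 2 - 1) * hY1)
    · rw [show pellY T 1 = 1 by rw [b]; ring]
      exact (sq_eq_sq_iff_eq_or_eq_neg (b := (1 : Polynomial F))).mp (by rw [hY1, one_pow])
  have hprod : (Y * T - X) * (Y * T + X) = Y ^ 2 - 1 := by linear_combination -h
  have hne : Y ^ 2 - 1 ≠ 0 := sub_ne_zero.mpr hY1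
  have hA : Y * T - X ≠ 0 := fun h0 => hne (by rw [← hprod, h0, zero_mul])
  have hB : Y * T + X ≠ 0 := fun h0 => hne (by rw [← hprod, h0, mul_zero])
  have hd : (Y * T - X).natDegree + (Y * T + X).natDegree ≤ 2 * m := by
    rw [← natDegree_mul hA hB, hprod]
    refine (natDegree_sub_le _ _).trans ?_
    simp [natDegree_pow, hm]
  have hT0 : T ≠ 0 := by rintro rfl; simp at hT
  have hsum : m + T.natDegree ≤ max (Y * T - X).natDegree (Y * T + X).natDegree := by
    have e : (Y * T - X) + (Y * T + X) = C 2 * (Y * T) := by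
      rw [show (C 2 : Polynomial F) = 2 from rfl]; ring
    have := natDegree_add_le (Y * T - X) (Y * T + X)
    rwa [e, natDegree_C_mul two_ne_zero, natDegree_mul hY hT0, hm] at this
  rcases le_max_iff.mp hsum with hs | hs
  · obtain ⟨N, h1, h2⟩ := key (-X) Y hm (by linear_combination h)
      (by rw [sub_neg_eq_add]; omega)
    refine ⟨N, ?_, h2⟩
    rcases h1 with h1 | h1
    · exact Or.inr (by rw [← h1, neg_neg])
    · exact Or.inl (neg_injective h1)
  · exact key X Y hm h (by omega)

/-- (Kollár) Over a field `F` of characteristic zero, for a nonconstant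
`T ∈ F[t]`, every solution `(X, Y)` of the Pell equation `X² − (T²−1)Y² = 1`
in `F[t]` is either `(±1, 0)` or `(±X_N, ±Y_N)` for some positive integer `N`,
the signs being chosen independently. -/
theorem kollar_pell_solutions {F : Type*} [Field F] [CharZero F]
    (T : Polynomial F) (hT : 0 < T.natDegree)
    (X Y : Polynomial F) (h : X ^ 2 - (T ^ 2 - 1) * Y ^ 2 = 1) :
    ((X = 1 ∨ X = -1) ∧ Y = 0) ∨
      ∃ N : ℕ, 0 < N ∧ (X = pellX T N ∨ X = -pellX T N) ∧
        (Y = pellY T N ∨ Y = -pellY T N) := by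
  obtain ⟨N, h1, h2⟩ := pell_descent T hT _ X Y rfl h
  rcases Nat.eq_zero_or_pos N with rfl | hN
  · left
    simpa [pellX, pellY] using And.intro h1 h2
  · exact Or.inr ⟨N, hN, h1, h2⟩
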